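/- Let p be an odd prime, r = (p−1)/2, ε = (−1)^r, K = CyclotomicField p ℚ, ζ ∈ K a primitive p-th root of unity, c an integer with p ∤ c, γ = Σ_{x ∈ ZMod p} ζ^{c·x²}, and g = Σ_{x ∈ ZMod p} ζ^{x²}. Let S and T be the (r+1)×(r+1) matrices over K with: T diagonal, T_{jj} = ζ^{c·j²}; S_{j,0} = ε·γ/p for all 0 ≤ j ≤ r, S_{0,k} = 2·ε·γ/p for 1 ≤ k ≤ r, and S_{j,k} = (ε·γ/p)·(ζ^{2cjk} + ζ^{−2cjk}) for 1 ≤ j, k ≤ r; and let V be the Vandermonde matrix V_{j,k} = ζ^{c·j²·k}. Let ξ be any group homomorphism from SL(2, ZMod p) to the invertible (r+1)×(r+1) matrices over K with ξ(s) = S and ξ(t) = T, where s = [[0,−1],[1,0]] and t = [[1,1],[0,1]]. Then for every element h ∈ SL(2, ZMod p) and all indices j, k, there exist integers a, b such that (V⁻¹ · ξ(h) · V)_{j,k} = a + b·(1+g)/2. In other words, the conjugated model h ↦ V⁻¹·ξ(h)·V is an integral model for the principal series Weil character defined over the ring of integers ℤ[(1+g)/2] of ℚ(√(εp)). -/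

import Mathlib

/-- The subring of algebraic integers of `K` fixed by every automorphism which acts on the values
of the additive character `ψ` through multiplication by a nonzero square. -/
def quadraticOrder {p : ℕ} {K : Type*} [Field K] [Algebra ℚ K] (ψ : AddChar (ZMod p) K) :
    Subring K where
  carrier := {α | IsIntegral ℤ α ∧ ∀ (σ : K ≃ₐ[ℚ] K) (e : (ZMod p)ˣ),
    (∀ x, σ (ψ x) = ψ ((e : ZMod p) ^ 2 * x)) → σ α = α}
  mul_mem' ha hb := ⟨ha.1.mul hb.1, fun σ e h => by rw [map_mul, ha.2 σ e h, hb.2 σ e h]⟩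
  one_mem' := ⟨isIntegral_one, fun σ _ _ => map_one σ⟩
  add_mem' ha hb := ⟨ha.1.add hb.1, fun σ e h => by rw [map_add, ha.2 σ e h, hb.2 σ e h]⟩
  zero_mem' := ⟨isIntegral_zero, fun σ _ _ => map_zero σ⟩
  neg_mem' ha := ⟨ha.1.neg, fun σ e h => by rw [map_neg, ha.2 σ e h]⟩

section Character

variable {p : ℕ} [hp : Fact p.Prime] {K : Type*} [Field K] {ψ : AddChar (ZMod p) K}

theorem quadraticOrder_mulShift_le [Algebra ℚ K] (c : ZMod p) :
    quadraticOrder (ψ.mulShift c) ≤ quadraticOrder ψ := by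
  intro α hα
  refine ⟨hα.1, fun σ e h => hα.2 σ e fun x => ?_⟩
  simp only [AddChar.mulShift_apply, h]
  congr 1
  ring

theorem AddChar.IsPrimitive.isPrimitiveRoot_zmod (hψ : ψ.IsPrimitive) {y : ZMod p} (hy : y ≠ 0) :
    IsPrimitiveRoot (ψ y) p := by
  refine IsPrimitiveRoot.mk_of_lt _ hp.out.pos ?_ fun l hl hlp h => ?_
  · rw [← AddChar.map_nsmul_eq_pow]
    simp
  · rw [← AddChar.map_nsmul_eq_pow, hψ.zmod_char_eq_one_iff p, nsmul_eq_mul, mul_eq_zero,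
      ZMod.natCast_eq_zero_iff] at h
    exact h.elim (fun h => Nat.not_dvd_of_pos_of_lt hl hlp h) hy

theorem AddChar.IsPrimitive.injective_zmod (hψ : ψ.IsPrimitive) : Function.Injective ψ := by
  intro x y h
  rw [← sub_eq_zero, ← hψ.zmod_char_eq_one_iff p, sub_eq_add_neg, AddChar.map_add_eq_mul, h,
    ← AddChar.map_add_eq_mul, add_neg_cancel, AddChar.map_zero_eq_one]

theorem AddChar.zmod_apply_eq_pow (x : ZMod p) : ψ x = ψ 1 ^ x.val := by
  rw [← AddChar.map_nsmul_eq_pow]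
  simp

theorem AddChar.isIntegral_zmod (x : ZMod p) : IsIntegral ℤ (ψ x) := by
  refine IsIntegral.of_pow hp.out.pos ?_
  rw [← AddChar.map_nsmul_eq_pow]
  simpa using isIntegral_one

theorem AddChar.IsPrimitive.sum_sq_mul (hψ : ψ.IsPrimitive) (hp2 : p ≠ 2) (a : ZMod p)
    (ha : a ≠ 0) :
    ∑ x, ψ (a * x ^ 2) = ((quadraticChar (ZMod p)).ringHomComp (Int.castRingHom K)) a *
      gaussSum ((quadraticChar (ZMod p)).ringHomComp (Int.castRingHom K)) ψ := by
  have hchar : ringChar (ZMod p) ≠ 2 := by rwa [ZMod.ringChar_zmod_n]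
  have h1 : ∑ x, ψ (a * x ^ 2) = ∑ y, ((quadraticChar (ZMod p) y : K) + 1) * ψ (a * y) := by
    rw [← Finset.sum_fiberwise (s := Finset.univ) (g := fun x : ZMod p => x ^ 2)]
    refine Finset.sum_congr rfl fun y _ => ?_
    rw [Finset.sum_congr rfl (g := fun _ => ψ (a * y))
      (fun x hx => by rw [(Finset.mem_filter.1 hx).2])]
    rw [Finset.sum_const, nsmul_eq_mul]
    congr 1
    have := quadraticChar_card_sqrts hchar y
    rw [← Int.cast_one, ← Int.cast_add, ← this]
    simp
  have h2 : ∑ y, ψ (a * y) = 0 := by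
    have := AddChar.sum_mulShift a hψ
    simpa [ha, mul_comm] using this
  have h3 := gaussSum_mulShift ((quadraticChar (ZMod p)).ringHomComp (Int.castRingHom K)) ψ
    (Units.mk0 a ha)
  have h4 : (quadraticChar (ZMod p) a : K) * (quadraticChar (ZMod p) a : K) = 1 := by
    rw [← sq]
    exact_mod_cast congrArg (Int.cast (R := K)) (quadraticChar_sq_one ha)
  simp only [add_mul, one_mul, Finset.sum_add_distrib, h2, add_zero] at h1
  rw [h1, ← h3]
  simp only [Units.val_mk0, MulChar.ringHomComp_apply, eq_intCast, ← mul_assoc, h4, one_mul,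
    gaussSum, AddChar.mulShift_apply]

theorem AddChar.IsPrimitive.sum_sq_eq_gaussSum (hψ : ψ.IsPrimitive) (hp2 : p ≠ 2) :
    ∑ x, ψ (x ^ 2) =
      gaussSum ((quadraticChar (ZMod p)).ringHomComp (Int.castRingHom K)) ψ := by
  simpa using hψ.sum_sq_mul hp2 1 one_ne_zero

theorem AddChar.IsPrimitive.sq_sum_sq [CharZero K] (hψ : ψ.IsPrimitive) (hp2 : p ≠ 2) :
    (∑ x, ψ (x ^ 2)) ^ 2 = (-1) ^ ((p - 1) / 2) * (p : K) := by
  have hchar : ringChar (ZMod p) ≠ 2 := by rwa [ZMod.ringChar_zmod_n]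
  rw [hψ.sum_sq_eq_gaussSum hp2, gaussSum_sq _ _ hψ]
  · have hodd := hp.out.eq_two_or_odd.resolve_left hp2
    rw [MulChar.ringHomComp_apply, quadraticChar_neg_one hchar, ZMod.card,
      ZMod.χ₄_eq_neg_one_pow hodd, show p / 2 = (p - 1) / 2 by omega]
    simp
  · rw [MulChar.ringHomComp_ne_one_iff (RingHom.injective_int _)]
    exact quadraticChar_ne_one hchar
  · exact (quadraticChar_isQuadratic _).comp _

theorem exists_algEquiv_addChar [CharZero K] [IsCyclotomicExtension {p} ℚ K] (hψ : ψ.IsPrimitive)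
    (d : (ZMod p)ˣ) : ∃ σ : K ≃ₐ[ℚ] K, ∀ x, σ (ψ x) = ψ (d * x) := by
  have hirr := Polynomial.cyclotomic.irreducible_rat hp.out.pos
  have h1 := hψ.isPrimitiveRoot_zmod one_ne_zero
  have hd := hψ.isPrimitiveRoot_zmod d.ne_zero
  have hm : minpoly ℚ (h1.powerBasis ℚ).gen = minpoly ℚ (hd.powerBasis ℚ).gen := by
    rw [IsPrimitiveRoot.powerBasis_gen, IsPrimitiveRoot.powerBasis_gen,
      ← h1.minpoly_eq_cyclotomic_of_irreducible hirr,
      ← hd.minpoly_eq_cyclotomic_of_irreducible hirr]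
  refine ⟨(h1.powerBasis ℚ).equivOfMinpoly (hd.powerBasis ℚ) hm, fun x => ?_⟩
  have h := (h1.powerBasis ℚ).equivOfMinpoly_gen (hd.powerBasis ℚ) hm
  simp only [IsPrimitiveRoot.powerBasis_gen] at h
  rw [AddChar.zmod_apply_eq_pow x, map_pow, h, ← AddChar.map_nsmul_eq_pow]
  simp [mul_comm]

theorem eq_of_sum_mul_addChar_eq_zero [CharZero K] [IsCyclotomicExtension {p} ℚ K]
    (hψ : ψ.IsPrimitive) (m : ZMod p → ℤ) (hm : ∑ x, (m x : K) * ψ x = 0) (x : ZMod p) :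
    m x = m 0 := by
  have h1 := hψ.isPrimitiveRoot_zmod one_ne_zero
  have hdeg : (minpoly ℚ (ψ 1)).natDegree = p - 1 := by
    rw [← h1.minpoly_eq_cyclotomic_of_irreducible
      (Polynomial.cyclotomic.irreducible_rat hp.out.pos), Polynomial.natDegree_cyclotomic,
      Nat.totient_prime hp.out]
  have hψ0 : ∑ x, ψ x = 0 := by
    have := AddChar.sum_mulShift 1 hψ
    simpa using this
  have hsum : ∑ i ∈ Finset.range p, ((m (i : ZMod p) - m ((p - 1 : ℕ) : ZMod p) : ℤ) : K) *
      ψ 1 ^ i = 0 := by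
    have h2 : ∑ x, ((m x - m ((p - 1 : ℕ) : ZMod p) : ℤ) : K) * ψ x = 0 := by
      simp only [Int.cast_sub, sub_mul, Finset.sum_sub_distrib, ← Finset.mul_sum, hm, hψ0]
      simp
    rw [← h2]
    refine Finset.sum_bij' (fun i _ => (i : ZMod p)) (fun x _ => x.val)
      (fun _ _ => Finset.mem_univ _) (fun x _ => Finset.mem_range.2 x.val_lt)
      (fun i hi => ZMod.val_cast_of_lt (Finset.mem_range.1 hi)) (fun x _ => ZMod.natCast_zmod_val x)
      fun i _ => ?_
    rw [← AddChar.map_nsmul_eq_pow]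
    simp
  have hp1 : p = p - 1 + 1 := by have := hp.out.pos; omega
  have hlast : ∀ i < p, m (i : ZMod p) = m ((p - 1 : ℕ) : ZMod p) := by
    intro i hi
    by_cases hip : i = p - 1
    · rw [hip]
    have hind := Fintype.linearIndependent_iff.1 (linearIndependent_pow (K := ℚ) (ψ 1))
      (fun i => ((m ((i : ℕ) : ZMod p) - m ((p - 1 : ℕ) : ZMod p) : ℤ) : ℚ)) (by
        rw [Finset.sum_fin_eq_sum_range, hdeg]
        rw [congrArg Finset.range hp1, Finset.sum_range_succ, sub_self, Int.cast_zero,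
          zero_mul, add_zero] at hsum
        rw [← hsum]
        refine Finset.sum_congr rfl fun j hj => ?_
        rw [dif_pos (Finset.mem_range.1 hj), Algebra.smul_def]
        simp) ⟨i, by omega⟩
    have := Int.cast_eq_zero.1 hind
    exact sub_eq_zero.1 this
  rw [← ZMod.natCast_zmod_val x, hlast _ x.val_lt, ← hlast 0 hp.out.pos, Nat.cast_zero]

theorem exists_eq_sum_mul_addChar [CharZero K] [IsCyclotomicExtension {p} ℚ K]
    (hψ : ψ.IsPrimitive) {α : K} (hα : IsIntegral ℤ α) :
    ∃ n : ZMod p → ℤ, α = ∑ x, (n x : K) * ψ x := by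
  have h1 := hψ.isPrimitiveRoot_zmod one_ne_zero
  obtain ⟨y, rfl⟩ :=
    (IsCyclotomicExtension.Rat.isIntegralClosure_adjoin_singleton_of_prime h1).isIntegral_iff.1 hα
  obtain ⟨P, hP⟩ := (Algebra.adjoin_singleton_eq_range_aeval ℤ (ψ 1)).le y.2
  have hP' : algebraMap _ K y = Polynomial.aeval (ψ 1) P := hP.symm
  rw [hP']
  clear hP hP'
  induction P using Polynomial.induction_on' with
  | add P Q hP hQ =>
    obtain ⟨n, hn⟩ := hP
    obtain ⟨m, hm⟩ := hQ
    exact ⟨n + m, by simp [hn, hm, add_mul, Finset.sum_add_distrib]⟩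
  | monomial k a =>
    refine ⟨Pi.single (k : ZMod p) a, ?_⟩
    rw [Finset.sum_eq_single (k : ZMod p)]
    · rw [Pi.single_eq_same, Polynomial.aeval_monomial, ← AddChar.map_nsmul_eq_pow]
      simp
    · intro x _ hx
      simp [Pi.single_eq_of_ne hx]
    · simp

theorem exists_int_of_mem_quadraticOrder [CharZero K] [IsCyclotomicExtension {p} ℚ K]
    (hψ : ψ.IsPrimitive) (hp2 : p ≠ 2) {α : K} (hα : α ∈ quadraticOrder ψ) :
    ∃ a b : ℤ, α = a + b * ((1 + ∑ x, ψ (x ^ 2)) / 2) := by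
  have hchar : ringChar (ZMod p) ≠ 2 := by rwa [ZMod.ringChar_zmod_n]
  obtain ⟨n, rfl⟩ := exists_eq_sum_mul_addChar hψ hα.1
  have hn : ∀ (e : (ZMod p)ˣ) (x : ZMod p), n ((e : ZMod p) ^ 2 * x) = n x := by
    intro e x
    obtain ⟨σ, hσ⟩ := exists_algEquiv_addChar hψ (e ^ 2)
    have h := hα.2 σ e (by simpa using hσ)
    have h2 : ∑ x, ((n ((e : ZMod p) ^ 2 * x) - n x : ℤ) : K) * ψ ((e : ZMod p) ^ 2 * x) = 0 := by
      simp only [Int.cast_sub, sub_mul, Finset.sum_sub_distrib]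
      have h3 := Equiv.sum_comp (Units.mulLeft (e ^ 2)) fun x => (n x : K) * ψ x
      simp only [Units.mulLeft_apply, Units.val_pow_eq_pow_val] at h3
      rw [h3, sub_eq_zero, ← h]
      simp [map_sum, hσ]
    have h3 := eq_of_sum_mul_addChar_eq_zero hψ
      (fun y => n y - n (((e ^ 2)⁻¹ : (ZMod p)ˣ) * y)) (by
        rw [← h2, ← Equiv.sum_comp (Units.mulLeft (e ^ 2))]
        simp) ((e : ZMod p) ^ 2 * x)
    simp at h3
    linarith
  obtain ⟨u, hu⟩ := quadraticChar_exists_neg_one hchar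
  have hu0 : u ≠ 0 := by rintro rfl; simp at hu
  have key : ∀ x, x ≠ 0 → ((n x : K)) =
      ((n 1 : K) + n u) / 2 + ((n 1 : K) - n u) / 2 * (quadraticChar (ZMod p) x : K) := by
    intro x hx
    rcases quadraticChar_dichotomy hx with h | h
    · obtain ⟨e, he⟩ := (quadraticChar_one_iff_isSquare hx).1 h
      have he0 : e ≠ 0 := by rintro rfl; simp at he; exact hx he
      have := hn (Units.mk0 e he0) 1
      rw [h, he, ← this]
      simp [sq]
      ring
    · have hxu : quadraticChar (ZMod p) (x * u) = 1 := by rw [map_mul, h, hu]; rfl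
      obtain ⟨e, he⟩ := (quadraticChar_one_iff_isSquare (mul_ne_zero hx hu0)).1 hxu
      have he0 : e / u ≠ 0 := by
        refine div_ne_zero ?_ hu0
        rintro rfl
        simp [hx, hu0] at he
      have := hn (Units.mk0 (e / u) he0) u
      have hxe : (e / u) ^ 2 * u = x := by
        field_simp
        rw [sq, ← he, mul_comm]
      rw [Units.val_mk0, hxe] at this
      rw [h, this]
      push_cast
      ring
  refine ⟨n 0 - n 1, n 1 - n u, ?_⟩
  have hψ0 : ∑ x, ψ x = 0 := by
    have := AddChar.sum_mulShift 1 hψ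
    simpa using this
  have hs : ∀ x, (n x : K) * ψ x = (((n 1 : K) + n u) / 2) * ψ x +
      ((n 1 : K) - n u) / 2 * ((quadraticChar (ZMod p) x : K) * ψ x) +
      if x = 0 then (n 0 : K) - ((n 1 : K) + n u) / 2 else 0 := by
    intro x
    by_cases hx : x = 0
    · simp [hx]
    · rw [key x hx, if_neg hx]
      ring
  rw [Finset.sum_congr rfl fun x _ => hs x, Finset.sum_add_distrib, Finset.sum_add_distrib,
    ← Finset.mul_sum, ← Finset.mul_sum, hψ0, Finset.sum_ite_eq', hψ.sum_sq_eq_gaussSum hp2]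
  simp only [gaussSum, MulChar.ringHomComp_apply, eq_intCast, Finset.mem_univ, if_true]
  push_cast
  ring

@[to_additive]
theorem ZMod.prod_range_natCast_succ {M : Type*} [CommMonoid M] {r : ℕ} (hr : p = 2 * r + 1)
    (F : ZMod p → M) :
    ∏ k ∈ Finset.range (r + r), F ((k + 1 : ℕ) : ZMod p) =
      ∏ i : Fin r, F (i.succ : ℕ) * F (-(i.succ : ℕ)) := by
  have h2 : (p : ZMod p) = 0 := ZMod.natCast_self p
  have h3 : ∏ i ∈ Finset.range r, F ((r + i + 1 : ℕ) : ZMod p) =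
      ∏ i ∈ Finset.range r, F (-((i + 1 : ℕ) : ZMod p)) := by
    refine Finset.prod_nbij' (fun i => r - 1 - i) (fun i => r - 1 - i) ?_ ?_ ?_ ?_ fun i hi => ?_
    any_goals intro i hi; simp only [Finset.mem_range] at hi ⊢; omega
    have hi := Finset.mem_range.1 hi
    congr 1
    rw [eq_neg_iff_add_eq_zero, ← h2, ← Nat.cast_add]
    congr 1
    omega
  rw [Finset.prod_range_add, h3, ← Finset.prod_mul_distrib,
    Finset.prod_range fun i => F ((i + 1 : ℕ) : ZMod p) * F (-((i + 1 : ℕ) : ZMod p))]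
  rfl

@[to_additive]
theorem ZMod.prod_univ_eq_mul_prod_neg {M : Type*} [CommMonoid M] {r : ℕ} (hr : p = 2 * r + 1)
    (F : ZMod p → M) :
    ∏ x, F x = F 0 * ∏ i : Fin r, F (i.succ : ℕ) * F (-(i.succ : ℕ)) := by
  have h1 : ∏ x, F x = ∏ i ∈ Finset.range p, F i := by
    symm
    refine Finset.prod_bij' (fun i _ => (i : ZMod p)) (fun x _ => x.val)
      (fun _ _ => Finset.mem_univ _) (fun x _ => Finset.mem_range.2 x.val_lt)
      (fun i hi => ZMod.val_cast_of_lt (Finset.mem_range.1 hi)) (fun x _ => ZMod.natCast_zmod_val x)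
      fun i _ => rfl
  rw [h1, congrArg Finset.range (show p = r + r + 1 by omega), Finset.prod_range_succ',
    ZMod.prod_range_natCast_succ hr, mul_comm, Nat.cast_zero]

open Polynomial in
/-- The monic polynomial whose roots are the `ψ (j ^ 2)` for `1 ≤ j ≤ r`. -/
noncomputable def squarePolynomial (ψ : AddChar (ZMod p) K) (r : ℕ) : K[X] :=
  ∏ i : Fin r, (X - C (ψ ((i.succ : ℕ) ^ 2 : ZMod p)))

theorem squarePolynomial_monic (r : ℕ) : (squarePolynomial ψ r).Monic :=
  Polynomial.monic_prod_of_monic _ _ fun _ _ => Polynomial.monic_X_sub_C _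

theorem eval_squarePolynomial_eq_zero {r : ℕ} (i : Fin r) :
    (squarePolynomial ψ r).eval (ψ ((i.succ : ℕ) ^ 2 : ZMod p)) = 0 := by
  rw [squarePolynomial, Polynomial.eval_prod]
  exact Finset.prod_eq_zero (Finset.mem_univ i) (by simp)

open Polynomial in
theorem X_sub_one_mul_squarePolynomial_sq {r : ℕ} (hr : p = 2 * r + 1) :
    (X - C 1) * squarePolynomial ψ r ^ 2 = ∏ x, (X - C (ψ (x ^ 2))) := by
  rw [ZMod.prod_univ_eq_mul_prod_neg hr, squarePolynomial, ← Finset.prod_pow]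
  simp only [neg_sq, zero_pow two_ne_zero, AddChar.map_zero_eq_one, sq (_ - _)]

theorem isIntegral_coeff_squarePolynomial (r k : ℕ) :
    IsIntegral ℤ ((squarePolynomial ψ r).coeff k) := by
  have h : squarePolynomial ψ r ∈ Polynomial.lifts (algebraMap (integralClosure ℤ K) K) := by
    refine Subsemiring.prod_mem _ fun i _ => ?_
    exact ⟨Polynomial.X - Polynomial.C ⟨_, AddChar.isIntegral_zmod _⟩, by simp; rfl⟩
  obtain ⟨y, hy⟩ := (Polynomial.lifts_iff_coeff_lifts _).1 h k
  rw [← hy]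
  exact y.2

open Polynomial in
theorem map_squarePolynomial [Algebra ℚ K] {r : ℕ} (hr : p = 2 * r + 1) (σ : K ≃ₐ[ℚ] K)
    (e : (ZMod p)ˣ) (hσ : ∀ x, σ (ψ x) = ψ ((e : ZMod p) ^ 2 * x)) :
    (squarePolynomial ψ r).map (σ : K →+* K) = squarePolynomial ψ r := by
  have : CharZero K := algebraRat.charZero K
  have h1 := congrArg (Polynomial.map (σ : K →+* K)) (X_sub_one_mul_squarePolynomial_sq (ψ := ψ) hr)
  rw [Polynomial.map_prod] at h1
  have h2 : ∏ x, (X - C (ψ (x ^ 2))).map (σ : K →+* K) = ∏ x, (X - C (ψ (x ^ 2))) := by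
    rw [← Equiv.prod_comp (Units.mulLeft e) fun x => (X - C (ψ (x ^ 2)))]
    refine Finset.prod_congr rfl fun x _ => ?_
    simp [hσ, mul_pow]
  rw [h2, ← X_sub_one_mul_squarePolynomial_sq hr, Polynomial.map_mul, Polynomial.map_pow] at h1
  have h3 : (X - C (1 : K)).map (σ : K →+* K) = X - C 1 := by simp
  rw [h3] at h1
  have h4 := mul_left_cancel₀ (X_sub_C_ne_zero (1 : K)) h1
  rcases sq_eq_sq_iff_eq_or_eq_neg.1 h4 with h | h
  · exact h
  · have hl := congrArg leadingCoeff h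
    rw [leadingCoeff_neg, squarePolynomial_monic r, (squarePolynomial_monic r).map] at hl
    norm_num at hl

theorem coeff_squarePolynomial_mem [Algebra ℚ K] {r : ℕ} (hr : p = 2 * r + 1) (k : ℕ) :
    (squarePolynomial ψ r).coeff k ∈ quadraticOrder ψ := by
  refine ⟨isIntegral_coeff_squarePolynomial r k, fun σ e h => ?_⟩
  have := congrArg (fun P => Polynomial.coeff P k) (map_squarePolynomial hr σ e h)
  simpa [Polynomial.coeff_map] using this

theorem isIntegral_one_sub_div (hψ : ψ.IsPrimitive) (x : ZMod p) {y : ZMod p} (hy : y ≠ 0) :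
    IsIntegral ℤ ((1 - ψ x) / (1 - ψ y)) := by
  have hx : ψ x = ψ y ^ (x / y).val := by
    rw [← AddChar.map_nsmul_eq_pow]
    simp [hy]
  have hy1 : 1 - ψ y ≠ 0 := by
    rw [sub_ne_zero]
    exact fun h => hy ((hψ.zmod_char_eq_one_iff p _).1 h.symm)
  rw [hx, ← mul_neg_geom_sum, mul_div_cancel_left₀ _ hy1]
  exact IsIntegral.sum _ fun i _ => (AddChar.isIntegral_zmod y).pow i

theorem natCast_succ_ne_zero_of_lt {r : ℕ} (hr : p = 2 * r + 1) (i : Fin r) :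
    ((i.succ : ℕ) : ZMod p) ≠ 0 := by
  rw [Ne, ZMod.natCast_eq_zero_iff]
  refine Nat.not_dvd_of_pos_of_lt (by simp) ?_
  have := i.2
  simp
  omega

theorem eval_one_squarePolynomial_ne_zero (hψ : ψ.IsPrimitive) {r : ℕ} (hr : p = 2 * r + 1) :
    (squarePolynomial ψ r).eval 1 ≠ 0 := by
  rw [squarePolynomial, Polynomial.eval_prod, Finset.prod_ne_zero_iff]
  intro i _ h
  rw [Polynomial.eval_sub, Polynomial.eval_X, Polynomial.eval_C, sub_eq_zero, eq_comm,
    hψ.zmod_char_eq_one_iff p] at h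
  exact natCast_succ_ne_zero_of_lt hr i (pow_eq_zero_iff two_ne_zero |>.1 h)

theorem eval_one_squarePolynomial_sq (r : ℕ) :
    (squarePolynomial ψ r).eval 1 ^ 2 =
      ∏ i : Fin r, (1 - ψ ((i.succ : ℕ) ^ 2 : ZMod p)) * (1 - ψ ((i.succ : ℕ) ^ 2 : ZMod p)) := by
  simp [squarePolynomial, Polynomial.eval_prod, ← Finset.prod_mul_distrib, sq]

theorem natCast_eq_prod_one_sub (hψ : ψ.IsPrimitive) {r : ℕ} (hr : p = 2 * r + 1) :
    (p : K) = ∏ i : Fin r, (1 - ψ (i.succ : ℕ)) * (1 - ψ (-(i.succ : ℕ))) := by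
  have h := (hψ.isPrimitiveRoot_zmod one_ne_zero)
  have hp1 : p = r + r + 1 := by omega
  rw [congrArg (IsPrimitiveRoot (ψ 1)) hp1] at h
  have h1 := ZMod.prod_range_natCast_succ hr fun x => 1 - ψ x
  rw [← h1, congrArg (Nat.cast (R := K)) hp1, Nat.cast_succ, ← h.prod_one_sub_pow_eq_order]
  refine Finset.prod_congr rfl fun k _ => ?_
  rw [← AddChar.map_nsmul_eq_pow]
  simp

theorem sum_sq_div_mem (hψ : ψ.IsPrimitive) [CharZero K] {r : ℕ} (hr : p = 2 * r + 1) :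
    (∑ x, ψ (x ^ 2)) / (squarePolynomial ψ r).eval 1 ∈ quadraticOrder ψ := by
  have hp2 : p ≠ 2 := by omega
  constructor
  · refine IsIntegral.of_pow two_pos ?_
    rw [div_pow, hψ.sq_sum_sq hp2, eval_one_squarePolynomial_sq r, mul_div_assoc,
      natCast_eq_prod_one_sub hψ hr, ← Finset.prod_div_distrib]
    refine IsIntegral.mul (isIntegral_one.neg.pow _) (IsIntegral.prod _ fun i _ => ?_)
    have h := pow_ne_zero 2 (natCast_succ_ne_zero_of_lt hr i)
    rw [mul_div_mul_comm]
    exact (isIntegral_one_sub_div hψ _ h).mul (isIntegral_one_sub_div hψ _ h)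
  · intro σ e h
    have h1 : σ (∑ x, ψ (x ^ 2)) = ∑ x, ψ (x ^ 2) := by
      rw [map_sum, ← Equiv.sum_comp (Units.mulLeft e) fun x => ψ (x ^ 2)]
      refine Finset.sum_congr rfl fun x _ => ?_
      simp [h, mul_pow]
    have h2 : σ ((squarePolynomial ψ r).eval 1) = (squarePolynomial ψ r).eval 1 := by
      conv_rhs => rw [← map_squarePolynomial hr σ e h]
      rw [Polynomial.eval_map, Polynomial.eval₂_at_one]
      rfl
    rw [map_div₀, h1, h2]

theorem injective_addChar_sq (hψ : ψ.IsPrimitive) {r : ℕ} (hr : p = 2 * r + 1) :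
    Function.Injective fun j : Fin (r + 1) => ψ ((j : ℕ) ^ 2 : ZMod p) := by
  intro j k h
  have h1 := hψ.injective_zmod h
  have hj := j.2
  have hk := k.2
  rcases sq_eq_sq_iff_eq_or_eq_neg.1 h1 with h | h
  · have := congrArg ZMod.val h
    rw [ZMod.val_cast_of_lt (by omega), ZMod.val_cast_of_lt (by omega)] at this
    exact Fin.ext this
  · rw [eq_neg_iff_add_eq_zero, ← Nat.cast_add, ZMod.natCast_eq_zero_iff] at h
    have := Nat.eq_zero_of_dvd_of_lt h (by omega)
    exact Fin.ext (by omega)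

open Polynomial in
theorem inv_vandermonde_mulVec_eval_mem [Algebra ℚ K] (hψ : ψ.IsPrimitive) {r : ℕ}
    (hr : p = 2 * r + 1) (P : K[X]) (hP : ∀ k, P.coeff k ∈ quadraticOrder ψ) (k : Fin (r + 1)) :
    ((Matrix.vandermonde fun j : Fin (r + 1) => ψ ((j : ℕ) ^ 2 : ZMod p))⁻¹.mulVec
      fun j => P.eval (ψ ((j : ℕ) ^ 2 : ZMod p))) k ∈ quadraticOrder ψ := by
  set v := fun j : Fin (r + 1) => ψ ((j : ℕ) ^ 2 : ZMod p) with hv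
  have hlift : ∀ Q : K[X], (∀ k, Q.coeff k ∈ quadraticOrder ψ) →
      Q ∈ lifts (quadraticOrder ψ).subtype := fun Q hQ =>
    (lifts_iff_coeff_lifts Q).2 fun k => ⟨⟨_, hQ k⟩, rfl⟩
  have hf : (X - C 1) * squarePolynomial ψ r ∈ lifts (quadraticOrder ψ).subtype :=
    Subsemiring.mul_mem _ ⟨X - C 1, by simp⟩ (hlift _ (coeff_squarePolynomial_mem hr))
  have hfm : ((X - C 1) * squarePolynomial ψ r).Monic :=
    (monic_X_sub_C _).mul (squarePolynomial_monic r)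
  obtain ⟨f, hfmap, hfdeg, hfmon⟩ := lifts_and_natDegree_eq_and_monic hf hfm
  obtain ⟨P', rfl⟩ := hlift P hP
  have hroot : ∀ j, ((X - C 1) * squarePolynomial ψ r).eval (v j) = 0 := by
    intro j
    refine Fin.cases ?_ (fun i => ?_) j
    · simp [hv]
    · rw [eval_mul, hv, eval_squarePolynomial_eq_zero, mul_zero]
  have hdeg : (P' %ₘ f).natDegree < r + 1 := by
    have h1 : ((X - C 1) * squarePolynomial ψ r).natDegree = r + 1 := by
      rw [(monic_X_sub_C _).natDegree_mul (squarePolynomial_monic r), natDegree_X_sub_C,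
        squarePolynomial, natDegree_prod_of_monic _ _ fun _ _ => monic_X_sub_C _]
      simp [add_comm]
    rw [← h1, ← hfdeg]
    refine natDegree_modByMonic_lt _ hfmon fun h => ?_
    rw [h, natDegree_one, h1] at hfdeg
    omega
  have heval : (fun j => (P'.map (quadraticOrder ψ).subtype).eval (v j)) =
      (Matrix.vandermonde v).mulVec fun k : Fin (r + 1) => ((P' %ₘ f).coeff k : K) := by
    ext j
    conv_lhs => rw [← modByMonic_add_div P' f]
    rw [Polynomial.map_add, Polynomial.map_mul, eval_add, eval_mul,
      hfmap, hroot, zero_mul, add_zero,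
      eval_eq_sum_range' (lt_of_le_of_lt natDegree_map_le hdeg), Finset.sum_range, Matrix.mulVec,
      dotProduct]
    refine Finset.sum_congr rfl fun i _ => ?_
    simp [Matrix.vandermonde_apply, mul_comm]
  have hdet : IsUnit (Matrix.vandermonde v).det :=
    (Matrix.det_vandermonde_ne_zero_iff.2 (injective_addChar_sq hψ hr)).isUnit
  change (Matrix.mulVec _ (fun j => (P'.map (quadraticOrder ψ).subtype).eval (v j))) k ∈ _
  rw [heval, Matrix.mulVec_mulVec, Matrix.nonsing_inv_mul _ hdet, Matrix.one_mulVec]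
  exact Subtype.property _

theorem inv_vandermonde_mul_mul_mem [Algebra ℚ K] (hψ : ψ.IsPrimitive) {r : ℕ}
    (hr : p = 2 * r + 1) {V M : Matrix (Fin (r + 1)) (Fin (r + 1)) K}
    (hV : V = Matrix.vandermonde fun j : Fin (r + 1) => ψ ((j : ℕ) ^ 2 : ZMod p))
    (hM : ∀ k, ∃ P : Polynomial K, (∀ i, P.coeff i ∈ quadraticOrder ψ) ∧
      ∀ j : Fin (r + 1), (M * V) j k = P.eval (ψ ((j : ℕ) ^ 2 : ZMod p))) :
    V⁻¹ * M * V ∈ (quadraticOrder ψ).matrix := by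
  intro j k
  obtain ⟨P, hP, hPe⟩ := hM k
  have h := inv_vandermonde_mulVec_eval_mem hψ hr P hP j
  rw [← hV] at h
  simp only [← hPe] at h
  rw [Matrix.mul_assoc, Matrix.mul_apply]
  exact h

open Polynomial in
theorem coeff_X_pow_mem (R : Subring K) (n i : ℕ) : ((X : K[X]) ^ n).coeff i ∈ R := by
  rw [coeff_X_pow]
  split_ifs
  exacts [R.one_mem, R.zero_mem]

theorem inv_vandermonde_mul_diagonal_mul_mem [Algebra ℚ K] (hψ : ψ.IsPrimitive) {r : ℕ}
    (hr : p = 2 * r + 1) {V : Matrix (Fin (r + 1)) (Fin (r + 1)) K}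
    (hV : V = Matrix.vandermonde fun j : Fin (r + 1) => ψ ((j : ℕ) ^ 2 : ZMod p)) :
    V⁻¹ * Matrix.diagonal (fun j : Fin (r + 1) => ψ ((j : ℕ) ^ 2 : ZMod p)) * V ∈
      (quadraticOrder ψ).matrix := by
  refine inv_vandermonde_mul_mul_mem hψ hr hV fun k =>
    ⟨Polynomial.X ^ ((k : ℕ) + 1), coeff_X_pow_mem _ _, fun j => ?_⟩
  rw [Matrix.diagonal_mul, hV, Matrix.vandermonde_apply, Polynomial.eval_pow, Polynomial.eval_X]
  exact (pow_succ' _ _).symm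

theorem sum_addChar_quadratic (hψ : ψ.IsPrimitive) (hp2 : p ≠ 2) {m : ZMod p} (hm : m ≠ 0)
    (j : ZMod p) :
    ∑ x, ψ (2 * j * x + m * x ^ 2) =
      (quadraticChar (ZMod p) m : K) * (∑ x, ψ (x ^ 2)) * ψ (j ^ 2) ^ (-m⁻¹).val := by
  rw [hψ.sum_sq_eq_gaussSum hp2]
  have h := hψ.sum_sq_mul hp2 m hm
  rw [MulChar.ringHomComp_apply, eq_intCast] at h
  rw [← h, ← Equiv.sum_comp (Equiv.addRight (-(j / m))), Finset.sum_mul]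
  refine Finset.sum_congr rfl fun x _ => ?_
  rw [← AddChar.map_nsmul_eq_pow, ← AddChar.map_add_eq_mul]
  congr 1
  simp only [Equiv.coe_addRight, nsmul_eq_mul, ZMod.natCast_zmod_val]
  field_simp
  ring

theorem inv_vandermonde_mul_weil_mul_mem [CharZero K] (hψ : ψ.IsPrimitive) {r : ℕ}
    (hr : p = 2 * r + 1) {V S : Matrix (Fin (r + 1)) (Fin (r + 1)) K}
    (hV : V = Matrix.vandermonde fun j : Fin (r + 1) => ψ ((j : ℕ) ^ 2 : ZMod p))
    (hS0 : ∀ j, S j 0 = (∑ x, ψ (x ^ 2))⁻¹)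
    (hS : ∀ (j : Fin (r + 1)) (k : Fin r), S j k.succ = (∑ x, ψ (x ^ 2))⁻¹ *
      (ψ (2 * (j : ℕ) * (k.succ : ℕ)) + ψ (-(2 * (j : ℕ) * (k.succ : ℕ))))) :
    V⁻¹ * S * V ∈ (quadraticOrder ψ).matrix := by
  have hp2 : p ≠ 2 := by omega
  have hp0 : (p : K) ≠ 0 := Nat.cast_ne_zero.2 hp.out.ne_zero
  have hγ2 := hψ.sq_sum_sq hp2
  set γ := ∑ x, ψ (x ^ 2) with hγ
  have hγ0 : γ ≠ 0 := by
    intro h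
    rw [h] at hγ2
    simp [hp0] at hγ2
  have hSV : ∀ j k : Fin (r + 1), (S * V) j k =
      γ⁻¹ * ∑ x, ψ (2 * (j : ℕ) * x + (k : ℕ) * x ^ 2) := by
    intro j k
    rw [ZMod.sum_univ_eq_add_sum_neg hr, Matrix.mul_apply, Fin.sum_univ_succ, hS0, mul_add,
      Finset.mul_sum, hV]
    congr 1
    · simp [Matrix.vandermonde_apply]
    · refine Finset.sum_congr rfl fun i _ => ?_
      rw [hS, Matrix.vandermonde_apply, ← AddChar.map_nsmul_eq_pow, nsmul_eq_mul, mul_assoc, add_mul,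
        ← AddChar.map_add_eq_mul, ← AddChar.map_add_eq_mul, neg_sq, mul_neg]
  refine inv_vandermonde_mul_mul_mem hψ hr hV fun k => ?_
  simp only [hSV]
  refine Fin.cases ?_ (fun i => ?_) k
  · refine ⟨Polynomial.C ((-1) ^ ((p - 1) / 2) * (γ / (squarePolynomial ψ r).eval 1)) *
      squarePolynomial ψ r, fun i => ?_, fun j => ?_⟩
    · rw [Polynomial.coeff_C_mul]
      exact mul_mem (mul_mem (pow_mem (neg_mem (one_mem _)) _) (sum_sq_div_mem hψ hr))
        (coeff_squarePolynomial_mem hr i)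
    · have hsum : ∑ x, ψ (2 * (j : ℕ) * x) = if (2 * (j : ℕ) : ZMod p) = 0 then (p : K) else 0 := by
        have := AddChar.sum_mulShift (2 * (j : ℕ) : ZMod p) hψ
        simpa [mul_comm] using this
      have htwo : (2 : ZMod p) ≠ 0 := by
        intro h
        have : ((2 : ℕ) : ZMod p) = 0 := by exact_mod_cast h
        rw [ZMod.natCast_eq_zero_iff] at this
        exact hp2 ((Nat.prime_dvd_prime_iff_eq hp.out Nat.prime_two).1 this)
      simp only [Fin.val_zero, Nat.cast_zero, zero_mul, add_zero, hsum]
      rw [Polynomial.eval_mul, Polynomial.eval_C]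
      refine Fin.cases ?_ (fun i => ?_) j
      · have h1 := eval_one_squarePolynomial_ne_zero hψ hr
        have hsq : ((-1 : K) ^ ((p - 1) / 2)) * (-1 : K) ^ ((p - 1) / 2) = 1 := by
          rw [← mul_pow]
          simp
        simp only [Fin.val_zero, Nat.cast_zero, mul_zero, if_true, zero_pow two_ne_zero,
          AddChar.map_zero_eq_one]
        field_simp
        rw [hγ2, mul_right_comm, hsq, one_mul]
      · rw [if_neg (mul_ne_zero htwo (natCast_succ_ne_zero_of_lt hr i)),
          eval_squarePolynomial_eq_zero, mul_zero, mul_zero]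
  · refine ⟨Polynomial.C ((quadraticChar (ZMod p) ((i.succ : ℕ) : ZMod p) : ℤ) : K) *
      Polynomial.X ^ (-((i.succ : ℕ) : ZMod p)⁻¹).val, fun i => ?_, fun j => ?_⟩
    · rw [Polynomial.coeff_C_mul]
      exact mul_mem (intCast_mem _ _) (coeff_X_pow_mem _ _ _)
    · rw [sum_addChar_quadratic hψ hp2 (natCast_succ_ne_zero_of_lt hr i), ← hγ]
      simp
      field_simp

end Character

theorem Submonoid.eq_top_of_SL2_zmod_generators_mem {p : ℕ} [Fact p.Prime]
    (H : Submonoid (Matrix.SpecialLinearGroup (Fin 2) (ZMod p)))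
    {s t : Matrix.SpecialLinearGroup (Fin 2) (ZMod p)}
    (hs : (s : Matrix (Fin 2) (Fin 2) (ZMod p)) = !![0, -1; 1, 0])
    (ht : (t : Matrix (Fin 2) (Fin 2) (ZMod p)) = !![1, 1; 0, 1]) (hsH : s ∈ H) (htH : t ∈ H) :
    H = ⊤ := by
  have hpow : ∀ n : ℕ, ((t ^ n : Matrix.SpecialLinearGroup (Fin 2) (ZMod p)) :
      Matrix (Fin 2) (Fin 2) (ZMod p)) = !![1, (n : ZMod p); 0, 1] := by
    intro n
    induction n with
    | zero => simp [Matrix.one_fin_two]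
    | succ n ih => rw [pow_succ, Matrix.SpecialLinearGroup.coe_mul, ih, ht]; simp [add_comm]
  have hne : ∀ h : Matrix.SpecialLinearGroup (Fin 2) (ZMod p), h 1 0 ≠ 0 → h ∈ H := by
    intro h h10
    have hdet := h.det_coe
    rw [Matrix.det_fin_two] at hdet
    have : h = t ^ ((h 0 0 + 1) / h 1 0).val * s * t ^ (h 1 0).val * s *
        t ^ ((h 1 1 + 1) / h 1 0).val := by
      apply Subtype.ext
      simp only [Matrix.SpecialLinearGroup.coe_mul, hpow, hs, ZMod.natCast_zmod_val]
      rw [Matrix.eta_fin_two (h : Matrix (Fin 2) (Fin 2) (ZMod p))]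
      ext i j
      fin_cases i <;> fin_cases j <;> simp <;> field_simp <;>
        first | ring1 | linear_combination -hdet
    rw [this]
    exact mul_mem (mul_mem (mul_mem (mul_mem (pow_mem htH _) hsH) (pow_mem htH _)) hsH)
      (pow_mem htH _)
  refine eq_top_iff.2 fun h _ => ?_
  by_cases h10 : h 1 0 = 0
  · have hdet := h.det_coe
    rw [Matrix.det_fin_two, h10, mul_zero, sub_zero] at hdet
    have h00 : h 0 0 ≠ 0 := left_ne_zero_of_mul_eq_one hdet
    have hsh : s * h ∈ H := by
      refine hne _ ?_
      rw [Matrix.SpecialLinearGroup.coe_mul, hs]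
      simpa [Matrix.mul_apply, Fin.sum_univ_two] using h00
    have hs4 : s ^ 3 * s = 1 := by
      apply Subtype.ext
      simp [pow_succ, Matrix.SpecialLinearGroup.coe_mul, hs, Matrix.one_fin_two]
    rw [← one_mul h, ← hs4, mul_assoc]
    exact mul_mem (pow_mem hsH _) hsh
  · exact hne h h10

/-- (Main theorem of the paper.)  The conjugated model
`h ↦ V⁻¹·ξ(h)·V` of the principal series Weil character is an integral model defined
over the quadratic ring `ℤ[(1+g)/2]`, the ring of integers of `ℚ(√(εp))`: every matrix
entry of `V⁻¹·ξ(h)·V` is of the form `a + b·(1+g)/2` with `a, b ∈ ℤ`. -/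
theorem minimal_integral_model_for_principal_series_weil_character
    (p : ℕ+) [hp : Fact (p : ℕ).Prime] (hp2 : (p : ℕ) ≠ 2)
    (r : ℕ) (hr : r = ((p : ℕ) - 1) / 2)
    (ε : ℤ) (hε : ε = (-1) ^ r)
    (ζ : CyclotomicField p ℚ) (hζ : IsPrimitiveRoot ζ (p : ℕ))
    (c : ℤ) (hc : ¬ ((p : ℕ) : ℤ) ∣ c)
    (γ : CyclotomicField p ℚ)
    (hγ : γ = ∑ x : ZMod (p : ℕ), ζ ^ (c * ((x.val : ℤ)) ^ 2))
    (g : CyclotomicField p ℚ)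
    (hg : g = ∑ x : ZMod (p : ℕ), ζ ^ ((x.val : ℤ) ^ 2))
    (S T V : Matrix (Fin (r + 1)) (Fin (r + 1)) (CyclotomicField p ℚ))
    (hT : T = Matrix.diagonal fun j : Fin (r + 1) => ζ ^ (c * ((j : ℕ) : ℤ) ^ 2))
    (hS0 : ∀ j, S j 0 = (ε : CyclotomicField p ℚ) * γ / ((p : ℕ) : CyclotomicField p ℚ))
    (hS1 : ∀ k, k ≠ 0 →
      S 0 k = 2 * ((ε : CyclotomicField p ℚ) * γ / ((p : ℕ) : CyclotomicField p ℚ)))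
    (hS2 : ∀ j k, j ≠ 0 → k ≠ 0 →
      S j k = (ε : CyclotomicField p ℚ) * γ / ((p : ℕ) : CyclotomicField p ℚ) *
        (ζ ^ (2 * c * ((j : ℕ) : ℤ) * ((k : ℕ) : ℤ)) +
          ζ ^ (-(2 * c * ((j : ℕ) : ℤ) * ((k : ℕ) : ℤ)))))
    (hV : ∀ j k : Fin (r + 1), V j k = ζ ^ (c * ((j : ℕ) : ℤ) ^ 2 * ((k : ℕ) : ℤ)))
    (s t : Matrix.SpecialLinearGroup (Fin 2) (ZMod (p : ℕ)))
    (hs : (s : Matrix (Fin 2) (Fin 2) (ZMod (p : ℕ))) = !![0, -1; 1, 0])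
    (ht : (t : Matrix (Fin 2) (Fin 2) (ZMod (p : ℕ))) = !![1, 1; 0, 1])
    (ξ : Matrix.SpecialLinearGroup (Fin 2) (ZMod (p : ℕ)) →*
      (Matrix (Fin (r + 1)) (Fin (r + 1)) (CyclotomicField p ℚ))ˣ)
    (hξs : ((ξ s : (Matrix (Fin (r + 1)) (Fin (r + 1)) (CyclotomicField p ℚ))ˣ) :
      Matrix (Fin (r + 1)) (Fin (r + 1)) (CyclotomicField p ℚ)) = S)
    (hξt : ((ξ t : (Matrix (Fin (r + 1)) (Fin (r + 1)) (CyclotomicField p ℚ))ˣ) :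
      Matrix (Fin (r + 1)) (Fin (r + 1)) (CyclotomicField p ℚ)) = T) :
    ∀ h : Matrix.SpecialLinearGroup (Fin 2) (ZMod (p : ℕ)), ∀ j k : Fin (r + 1),
      ∃ a b : ℤ,
        (V⁻¹ * ((ξ h : (Matrix (Fin (r + 1)) (Fin (r + 1)) (CyclotomicField p ℚ))ˣ) :
            Matrix (Fin (r + 1)) (Fin (r + 1)) (CyclotomicField p ℚ)) * V) j k =
          (a : CyclotomicField p ℚ) + (b : CyclotomicField p ℚ) * ((1 + g) / 2) := by
  have hp2' : Odd (p : ℕ) := hp.out.odd_of_ne_two hp2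
  have hpr : (p : ℕ) = 2 * r + 1 := by
    obtain ⟨m, hm⟩ := hp2'
    omega
  set ψ₀ : AddChar (ZMod (p : ℕ)) (CyclotomicField p ℚ) := AddChar.zmodChar _ hζ.pow_eq_one
    with hψ₀_def
  have hψ₀ : ψ₀.IsPrimitive := AddChar.zmodChar_primitive_of_primitive_root _ hζ
  have hz : ∀ n : ℤ, ζ ^ n = ψ₀ n := by
    intro n
    have h1 : ψ₀ 1 = ζ := by simpa using AddChar.zmodChar_apply' hζ.pow_eq_one 1
    rw [← h1, ← AddChar.map_zsmul_eq_zpow]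
    simp
  have hc0 : (c : ZMod (p : ℕ)) ≠ 0 := by rwa [Ne, ZMod.intCast_zmod_eq_zero_iff_dvd]
  set ψ := ψ₀.mulShift (c : ZMod (p : ℕ)) with hψ_def
  have hψ : ψ.IsPrimitive := by
    refine AddChar.IsPrimitive.of_ne_one ?_
    exact hψ₀ hc0
  have hψγ : γ = ∑ x, ψ (x ^ 2) := by
    simp [hγ, hz, hψ_def, AddChar.mulShift_apply]
  have hψg : g = ∑ x, ψ₀ (x ^ 2) := by
    simp [hg, hz]
  have hγ2 := hψ.sq_sum_sq hp2
  rw [← hψγ, ← hr] at hγ2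
  have hp0 : ((p : ℕ) : CyclotomicField p ℚ) ≠ 0 := Nat.cast_ne_zero.2 hp.out.ne_zero
  have hγinv : (ε : CyclotomicField p ℚ) * γ / ((p : ℕ) : CyclotomicField p ℚ) =
      (∑ x, ψ (x ^ 2))⁻¹ := by
    have hεε : (ε : CyclotomicField p ℚ) * ε = 1 := by
      rw [hε]
      push_cast
      rw [← mul_pow]
      simp
    rw [← hψγ]
    refine eq_inv_of_mul_eq_one_left ?_
    rw [div_mul_eq_mul_div, mul_assoc, ← sq, hγ2, hε]
    rw [hε] at hεε
    push_cast at hεε ⊢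
    rw [← mul_assoc, hεε, one_mul, div_self hp0]
  rw [hγinv] at hS1
  simp only [hγinv] at hS0 hS2
  have hVand : V = Matrix.vandermonde fun j : Fin (r + 1) => ψ ((j : ℕ) ^ 2 : ZMod (p : ℕ)) := by
    ext j k
    rw [hV, zpow_mul, zpow_natCast, Matrix.vandermonde_apply, hz, hψ_def, AddChar.mulShift_apply]
    push_cast
    rfl
  have hTdiag : T = Matrix.diagonal fun j : Fin (r + 1) => ψ ((j : ℕ) ^ 2 : ZMod (p : ℕ)) := by
    rw [hT]
    congr 1
    ext j
    rw [hz, hψ_def, AddChar.mulShift_apply]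
    push_cast
    rfl
  have hSmem := inv_vandermonde_mul_weil_mul_mem hψ hpr hVand hS0 (S := S) fun j k => by
    by_cases hj : j = 0
    · rw [hj, hS1 _ (Fin.succ_ne_zero k)]
      simp
      ring
    · rw [hS2 j _ hj (Fin.succ_ne_zero k), hz, hz, hψ_def, AddChar.mulShift_apply,
        AddChar.mulShift_apply]
      push_cast
      congr 3 <;> ring
  have hTmem := inv_vandermonde_mul_diagonal_mul_mem hψ hpr hVand
  rw [← hTdiag] at hTmem
  have hdet : IsUnit V.det := by
    rw [hVand]
    exact (Matrix.det_vandermonde_ne_zero_iff.2 (injective_addChar_sq hψ hpr)).isUnit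
  let H : Submonoid (Matrix.SpecialLinearGroup (Fin 2) (ZMod (p : ℕ))) :=
    { carrier := {h | V⁻¹ * (ξ h : Matrix (Fin (r + 1)) (Fin (r + 1)) (CyclotomicField p ℚ)) * V ∈
        (quadraticOrder ψ).matrix}
      one_mem' := by
        rw [Set.mem_ofPred_eq, map_one, Units.val_one, Matrix.mul_one,
          Matrix.nonsing_inv_mul _ hdet]
        exact one_mem _
      mul_mem' := by
        intro a b ha hb
        have h := (quadraticOrder ψ).matrix.mul_mem ha hb
        rw [Set.mem_ofPred_eq, map_mul, Units.val_mul]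
        convert h using 1
        simp only [Matrix.mul_assoc]
        rw [Matrix.mul_nonsing_inv_cancel_left _ _ hdet] }
  have hH : H = ⊤ := H.eq_top_of_SL2_zmod_generators_mem hs ht
    (by simpa [H, hξs] using hSmem) (by simpa [H, hξt] using hTmem)
  have : NeZero (((p : ℕ) : ℕ) : ℚ) := ⟨Nat.cast_ne_zero.2 hp.out.ne_zero⟩
  have hcyc : IsCyclotomicExtension {(p : ℕ)} ℚ (CyclotomicField p ℚ) := by
    have h : (DivisionRing.toRatAlgebra : Algebra ℚ (CyclotomicField p ℚ)) =
        CyclotomicField.algebra _ _ := Subsingleton.elim _ _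
    rw [h]
    exact CyclotomicField.isCyclotomicExtension p ℚ
  intro h j k
  have hh : h ∈ H := hH ▸ Submonoid.mem_top h
  rw [hψg]
  exact exists_int_of_mem_quadraticOrder hψ₀ hp2 (quadraticOrder_mulShift_le _ (hh j k))
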